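/- Let F be a field with char F ≠ 2, n ≥ 1, and let d ≤ n. Set W = span(e_1, …, e_d) and W̄ = span(e_{2n+2−d}, …, e_{2n+1}), so that F^{2n+1} = W^⊥ ⊕ W̄, and let p_{W̄} : F^{2n+1} → W̄ be the projection with respect to this decomposition. Let V be a maximally isotropic subspace of F^{2n+1}, i.e. an isotropic subspace with dim V = n. Then: (i) p_{W̄}(V) = {w ∈ W̄ : (v, w) = 0 for all v ∈ W ∩ V}; in particular dim p_{W̄}(V) = d − dim(W ∩ V); (ii) dim(W^⊥ ∩ V) = (n − d) + dim(W ∩ V). -/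

import Mathlib

open Module

/-- The symmetric bilinear form on `F^N` given by `(e_i, e_j) = δ_{i, N+1-j}`
(in 1-indexed notation), i.e. `(u, v) = ∑ i, u i * v (rev i)`. -/
def bform (F : Type*) [Field F] (N : ℕ) (u v : Fin N → F) : F :=
  ∑ i, u i * v i.rev

/-- `g` belongs to the split orthogonal group `O_N(F)`. -/
def IsOrthMap (F : Type*) [Field F] (N : ℕ)
    (g : (Fin N → F) ≃ₗ[F] (Fin N → F)) : Prop :=
  ∀ u v, bform F N (g u) (g v) = bform F N u v

/-- A subspace `V` is isotropic if `(V, V) = {0}`. -/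
def IsIsotropic (F : Type*) [Field F] (N : ℕ) (V : Submodule F (Fin N → F)) : Prop :=
  ∀ u ∈ V, ∀ v ∈ V, bform F N u v = 0

/-- The orthogonal space `S^⊥ = {v : (v, S) = {0}}` of a subspace `S`. -/
def orthCompl (F : Type*) [Field F] (N : ℕ) (S : Submodule F (Fin N → F)) :
    Submodule F (Fin N → F) where
  carrier := {v | ∀ s ∈ S, bform F N v s = 0}
  zero_mem' := by
    intro s hs
    simp [bform]
  add_mem' := by
    intro a b ha hb s hs
    have h1 := ha s hs
    have h2 := hb s hs
    simp only [bform, Pi.add_apply, add_mul, Finset.sum_add_distrib] at h1 h2 ⊢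
    rw [h1, h2, add_zero]
  smul_mem' := by
    intro t v hv s hs
    have h1 := hv s hs
    simp only [bform, Pi.smul_apply, smul_eq_mul, mul_assoc, ← Finset.mul_sum] at h1 ⊢
    rw [h1, mul_zero]

/-- The projection `p_{W̄} : F^{2n+1} = W^⊥ ⊕ W̄ → W̄`, where
`W = span(e_1, …, e_d)` and `W̄ = span(e_{2n+2-d}, …, e_{2n+1})`; concretely it keeps
the last `d` coordinates (indices `≥ 2n+1-d` in 0-indexed notation) and kills the
others, since `W^⊥` consists of the vectors supported on the first `2n+1-d`
coordinates. -/
def projBar (F : Type*) [Field F] (n d : ℕ) :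
    (Fin (2*n+1) → F) →ₗ[F] (Fin (2*n+1) → F) where
  toFun v := fun i => if 2*n+1-d ≤ (i : ℕ) then v i else 0
  map_add' u v := by
    funext i
    by_cases h : 2*n+1-d ≤ (i : ℕ)
    · simp only [Pi.add_apply, if_pos h]
    · simp only [Pi.add_apply, if_neg h, add_zero]
  map_smul' t v := by
    funext i
    by_cases h : 2*n+1-d ≤ (i : ℕ)
    · simp only [Pi.smul_apply, RingHom.id_apply, if_pos h]
    · simp only [Pi.smul_apply, RingHom.id_apply, if_neg h, smul_zero]

/-- `bform` bundled as a bilinear form. -/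
noncomputable def bformBilin (F : Type*) [Field F] (N : ℕ) :
    LinearMap.BilinForm F (Fin N → F) :=
  LinearMap.mk₂ F (bform F N)
    (fun a b c => by simp [bform, add_mul, Finset.sum_add_distrib])
    (fun t a b => by simp [bform, mul_assoc, Finset.mul_sum])
    (fun a b c => by simp [bform, mul_add, Finset.sum_add_distrib])
    (fun t a b => by simp [bform, Finset.mul_sum, mul_left_comm])

section

variable {F : Type*} [Field F] {N : ℕ}

theorem bformBilin_apply (u v : Fin N → F) : bformBilin F N u v = bform F N u v := rfl

theorem bform_comm (u v : Fin N → F) : bform F N u v = bform F N v u := by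
  unfold bform
  rw [← Equiv.sum_comp Fin.revPerm]
  simp [mul_comm]

theorem bform_single (u : Fin N → F) (i : Fin N) :
    bform F N u (Pi.single i 1) = u i.rev := by
  unfold bform
  rw [Finset.sum_eq_single i.rev]
  · simp
  · intro j _ hj
    have : j.rev ≠ i := fun h => hj (by rw [← h, Fin.rev_rev])
    simp [this]
  · simp

theorem bformBilin_isRefl : (bformBilin F N).IsRefl := fun u v h => by
  rw [bformBilin_apply] at h ⊢
  rwa [bform_comm]

theorem bformBilin_nondegenerate : (bformBilin F N).Nondegenerate := by
  have key : ∀ u : Fin N → F, (∀ v, bform F N u v = 0) → u = 0 := fun u hu => by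
    funext i
    simpa [bform_single] using hu (Pi.single i.rev 1)
  refine ⟨fun u hu => key u hu, fun u hu => key u fun v => ?_⟩
  rw [bform_comm]
  exact hu v

theorem mem_orthCompl {S : Submodule F (Fin N → F)} {v : Fin N → F} :
    v ∈ orthCompl F N S ↔ ∀ s ∈ S, bform F N v s = 0 := Iff.rfl

theorem orthCompl_eq_orthogonal (S : Submodule F (Fin N → F)) :
    orthCompl F N S = (bformBilin F N).orthogonal S := by
  ext v
  rw [mem_orthCompl, LinearMap.BilinForm.mem_orthogonal_iff]
  refine forall₂_congr fun s _ => ?_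
  rw [bform_comm]
  rfl

theorem finrank_orthCompl (S : Submodule F (Fin N → F)) :
    finrank F (orthCompl F N S) = N - finrank F S := by
  rw [orthCompl_eq_orthogonal,
    LinearMap.BilinForm.finrank_orthogonal bformBilin_nondegenerate, finrank_fin_fun]

theorem orthCompl_orthCompl (S : Submodule F (Fin N → F)) :
    orthCompl F N (orthCompl F N S) = S := by
  rw [orthCompl_eq_orthogonal, orthCompl_eq_orthogonal,
    LinearMap.BilinForm.orthogonal_orthogonal bformBilin_nondegenerate bformBilin_isRefl]

theorem orthCompl_sup (S T : Submodule F (Fin N → F)) :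
    orthCompl F N (S ⊔ T) = orthCompl F N S ⊓ orthCompl F N T := by
  ext v
  simp only [Submodule.mem_inf, mem_orthCompl]
  refine ⟨fun h => ⟨fun s hs => h s (Submodule.mem_sup_left hs),
    fun s hs => h s (Submodule.mem_sup_right hs)⟩, fun h x hx => ?_⟩
  obtain ⟨s, hs, t, ht, rfl⟩ := Submodule.mem_sup.1 hx
  have := (bformBilin F N v).map_add s t
  simp only [bformBilin_apply] at this
  rw [this, h.1 s hs, h.2 t ht, add_zero]

theorem isIsotropic_iff_le_orthCompl {V : Submodule F (Fin N → F)} :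
    IsIsotropic F N V ↔ V ≤ orthCompl F N V := Iff.rfl

theorem IsIsotropic.two_mul_finrank_le {V : Submodule F (Fin N → F)}
    (hV : IsIsotropic F N V) : 2 * finrank F V ≤ N := by
  have h := Submodule.finrank_mono (isIsotropic_iff_le_orthCompl.1 hV)
  have h' := Submodule.finrank_le V
  rw [finrank_orthCompl] at h
  rw [finrank_fin_fun] at h'
  omega

/-- Isotropic vectors orthogonal to an isotropic subspace span with it an isotropic subspace. -/
theorem IsIsotropic.sup {V U : Submodule F (Fin N → F)} (hV : IsIsotropic F N V)
    (hU : IsIsotropic F N U) (hUV : U ≤ orthCompl F N V) : IsIsotropic F N (V ⊔ U) := by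
  have hVU : V ≤ orthCompl F N U := fun v hv u hu => by
    rw [bform_comm]
    exact hUV hu v hv
  rw [isIsotropic_iff_le_orthCompl, orthCompl_sup]
  exact sup_le (le_inf hV hVU) (le_inf hUV hU)

/-- If no isotropic subspace is larger than `V`, an isotropic subspace meets `V^⊥` inside `V`. -/
theorem IsIsotropic.inf_orthCompl_eq {V W : Submodule F (Fin N → F)} (hV : IsIsotropic F N V)
    (hW : IsIsotropic F N W) (hN : N < 2 * (finrank F V + 1)) :
    W ⊓ orthCompl F N V = W ⊓ V := by
  refine le_antisymm (le_inf inf_le_left ?_) (inf_le_inf_left _ hV)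
  have hU : IsIsotropic F N (W ⊓ orthCompl F N V) := fun u hu v hv => hW u hu.1 v hv.1
  have h := (hV.sup hU inf_le_right).two_mul_finrank_le
  have : V = V ⊔ W ⊓ orthCompl F N V :=
    Submodule.eq_of_le_of_finrank_le le_sup_left (by omega)
  exact le_sup_right.trans this.ge

theorem mem_span_single_iff {ι : Type*} [Finite ι] [DecidableEq ι] {P : ι → Prop} {v : ι → F} :
    v ∈ Submodule.span F {v : ι → F | ∃ i, P i ∧ v = Pi.single i 1} ↔ ∀ i, ¬ P i → v i = 0 := by
  have := Fintype.ofFinite ι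
  refine ⟨fun h i hi => ?_, fun h => ?_⟩
  · refine Submodule.span_le (p := LinearMap.ker (LinearMap.proj (R := F) (φ := fun _ => F) i)).2
      ?_ h
    rintro _ ⟨j, hj, rfl⟩
    have : i ≠ j := fun e => hi (e ▸ hj)
    simp [this]
  · rw [pi_eq_sum_univ' v]
    refine Submodule.sum_mem _ fun i _ => ?_
    by_cases hi : P i
    · refine Submodule.smul_mem _ _ (Submodule.subset_span ⟨i, hi, ?_⟩)
      ext j
      simp [Pi.single_apply, eq_comm]
    · simp [h i hi]

theorem finrank_span_single {ι : Type*} [Fintype ι] [DecidableEq ι] (P : ι → Prop)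
    [DecidablePred P] :
    finrank F (Submodule.span F {v : ι → F | ∃ i, P i ∧ v = Pi.single i 1}) =
      Fintype.card {i // P i} := by
  have hli : LinearIndependent F fun i : {i // P i} => (Pi.single (i : ι) 1 : ι → F) :=
    (Pi.linearIndependent_single_one ι F).comp _ Subtype.val_injective
  rw [← finrank_span_eq_card hli]
  have hset : {v : ι → F | ∃ i, P i ∧ v = Pi.single i 1} =
      Set.range fun i : {i // P i} => (Pi.single (i : ι) 1 : ι → F) := by
    ext v
    simp [eq_comm]
  rw [hset]

theorem finrank_map_add_finrank_ker_inf {M M' : Type*} [AddCommGroup M] [Module F M]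
    [AddCommGroup M'] [Module F M'] (f : M →ₗ[F] M') (V : Submodule F M) [FiniteDimensional F V] :
    finrank F (V.map f) + finrank F ↥(LinearMap.ker f ⊓ V) = finrank F V := by
  rw [← LinearMap.finrank_range_add_finrank_ker (f.domRestrict V), LinearMap.range_domRestrict,
    LinearMap.ker_domRestrict, inf_comm, ← Submodule.map_comap_subtype,
    Submodule.finrank_map_subtype_eq]

theorem mem_orthCompl_span_single_iff {P : Fin N → Prop} {v : Fin N → F} :
    v ∈ orthCompl F N (Submodule.span F {v : Fin N → F | ∃ i, P i ∧ v = Pi.single i 1}) ↔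
      ∀ i, P i → v i.rev = 0 := by
  refine ⟨fun h i hi => ?_, fun h s hs => ?_⟩
  · rw [← bform_single v i]
    exact h _ (Submodule.subset_span ⟨i, hi, rfl⟩)
  · refine Finset.sum_eq_zero fun i _ => ?_
    by_cases hi : P i.rev
    · rw [← Fin.rev_rev i, h _ hi, zero_mul]
    · rw [mem_span_single_iff.1 hs _ hi, mul_zero]

end

/-- Lemma 3.4: for `d ≤ n`, `W = span(e_1, …, e_d)`,
`W̄ = span(e_{2n+2-d}, …, e_{2n+1})` and a maximally isotropic subspace `V` of
`F^{2n+1}`: (i) `p_{W̄}(V)` is the orthogonal space of `W ∩ V` in `W̄`, so that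
`dim p_{W̄}(V) = d - dim(W ∩ V)`; (ii) `dim(W^⊥ ∩ V) = (n - d) + dim(W ∩ V)`. -/
theorem statement15 (F : Type*) [Field F] (hchar : (2 : F) ≠ 0)
    (n d : ℕ) (hn : 1 ≤ n) (hd : d ≤ n)
    (W Wbar : Submodule F (Fin (2*n+1) → F))
    (hW : W = Submodule.span F {v : Fin (2*n+1) → F |
      ∃ i : Fin (2*n+1), (i : ℕ) < d ∧ v = Pi.single i 1})
    (hWbar : Wbar = Submodule.span F {v : Fin (2*n+1) → F |
      ∃ i : Fin (2*n+1), 2*n+1-d ≤ (i : ℕ) ∧ v = Pi.single i 1})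
    (V : Submodule F (Fin (2*n+1) → F))
    (hViso : IsIsotropic F (2*n+1) V) (hVdim : finrank F V = n) :
    Submodule.map (projBar F n d) V = Wbar ⊓ orthCompl F (2*n+1) (W ⊓ V) ∧
      finrank F (Submodule.map (projBar F n d) V) = d - finrank F ↥(W ⊓ V) ∧
      finrank F ↥(orthCompl F (2*n+1) W ⊓ V) = (n - d) + finrank F ↥(W ⊓ V) := by
  have hWmem : ∀ v, v ∈ W ↔ ∀ i : Fin (2*n+1), ¬ (i : ℕ) < d → v i = 0 := fun v => by
    rw [hW, mem_span_single_iff]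
  have hWbarmem : ∀ v, v ∈ Wbar ↔ ∀ i : Fin (2*n+1), ¬ 2*n+1-d ≤ (i : ℕ) → v i = 0 := fun v => by
    rw [hWbar, mem_span_single_iff]
  have hWorth : ∀ v, v ∈ orthCompl F (2*n+1) W ↔
      ∀ i : Fin (2*n+1), (i : ℕ) < d → v i.rev = 0 := fun v => by
    rw [hW, mem_orthCompl_span_single_iff]
  have hWbarorth : ∀ v, v ∈ orthCompl F (2*n+1) Wbar ↔
      ∀ i : Fin (2*n+1), 2*n+1-d ≤ (i : ℕ) → v i.rev = 0 := fun v => by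
    rw [hWbar, mem_orthCompl_span_single_iff]
  have hlt : Fintype.card {i : Fin (2*n+1) // (i : ℕ) < d} = d := by
    rw [Fintype.card_subtype, Fin.card_filter_val_lt]
    omega
  have hWdim : finrank F W = d := by
    rw [hW, finrank_span_single, hlt]
  have hWbardim : finrank F Wbar = d := by
    rw [hWbar, finrank_span_single, ← hlt]
    refine Fintype.card_congr (Fin.revPerm.subtypeEquiv fun i => ?_)
    simp only [Fin.revPerm_apply, Fin.val_rev]
    omega
  have hWiso : IsIsotropic F (2*n+1) W := fun u hu => by
    refine (hWorth u).2 fun i hi => (hWmem u).1 hu _ ?_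
    rw [Fin.val_rev]
    omega
  have hker : LinearMap.ker (projBar F n d) = orthCompl F (2*n+1) W := by
    ext v
    rw [LinearMap.mem_ker, hWorth]
    refine ⟨fun h i hi => ?_, fun h => funext fun i => ?_⟩
    · have h' : 2*n+1-d ≤ (i.rev : ℕ) := by
        rw [Fin.val_rev]
        omega
      have h'' : (if 2*n+1-d ≤ (i.rev : ℕ) then v i.rev else 0) = 0 := congrFun h i.rev
      rwa [if_pos h'] at h''
    · change (if 2*n+1-d ≤ (i : ℕ) then v i else 0) = 0
      split_ifs with hi
      · rw [← Fin.rev_rev i]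
        refine h _ ?_
        rw [Fin.val_rev]
        omega
      · rfl
  have hWV := hViso.inf_orthCompl_eq hWiso (by omega)
  have hWVle : finrank F ↥(W ⊓ V) ≤ d := hWdim ▸ Submodule.finrank_mono inf_le_left
  have hinter : finrank F ↥(orthCompl F (2*n+1) W ⊓ V) = (n - d) + finrank F ↥(W ⊓ V) := by
    have h := Submodule.finrank_sup_add_finrank_inf_eq W (orthCompl F (2*n+1) V)
    rw [hWV, finrank_orthCompl, hWdim, hVdim] at h
    conv_lhs => rw [← orthCompl_orthCompl V]
    rw [← orthCompl_sup, finrank_orthCompl]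
    omega
  have hmap : finrank F (Submodule.map (projBar F n d) V) = d - finrank F ↥(W ⊓ V) := by
    have h := finrank_map_add_finrank_ker_inf (projBar F n d) V
    rw [hker, hinter, hVdim] at h
    omega
  have htarget : finrank F ↥(Wbar ⊓ orthCompl F (2*n+1) (W ⊓ V)) = d - finrank F ↥(W ⊓ V) := by
    have hdisj : orthCompl F (2*n+1) Wbar ⊓ (W ⊓ V) = ⊥ := by
      refine (Submodule.eq_bot_iff _).2 fun v hv => funext fun i => ?_
      by_cases hi : (i : ℕ) < d
      · rw [← Fin.rev_rev i]
        refine (hWbarorth v).1 hv.1 _ ?_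
        rw [Fin.val_rev]
        omega
      · exact (hWmem v).1 hv.2.1 i hi
    have h := Submodule.finrank_sup_add_finrank_inf_eq (orthCompl F (2*n+1) Wbar) (W ⊓ V)
    rw [hdisj, finrank_bot, finrank_orthCompl, hWbardim] at h
    conv_lhs => rw [← orthCompl_orthCompl Wbar]
    rw [← orthCompl_sup, finrank_orthCompl]
    omega
  refine ⟨Submodule.eq_of_le_of_finrank_le ?_ (htarget.trans hmap.symm).le, hmap, hinter⟩
  rintro _ ⟨v, hv, rfl⟩
  refine ⟨(hWbarmem _).2 fun i hi => if_neg hi, fun w hw => ?_⟩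
  rw [← hViso v hv w hw.2]
  refine Finset.sum_congr rfl fun i _ => ?_
  change (if 2*n+1-d ≤ (i : ℕ) then v i else 0) * w i.rev = v i * w i.rev
  split_ifs with hi
  · rfl
  · rw [(hWmem w).1 hw.1 i.rev (by rw [Fin.val_rev]; omega), mul_zero, mul_zero]
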